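/- The function (x,Υ) ↦ f_DDFact(x;Υ) is continuous on the set {(x,Υ) : Υ ∈ R^n_{++}, x ∈ dom(f_DDFact;Υ)_+}. (Corollary 1) -/

import Mathlib

open Matrix
open scoped Matrix BigOperators Classical

noncomputable section

/-- `(1/(s−ι)) Σ_{ℓ=ι+1}^k λ_ℓ` (eigenvalues indexed from `1`). -/
def avgTail (k s : ℕ) (lam : ℕ → ℝ) (ι : ℕ) : ℝ :=
  (∑ ℓ ∈ Finset.Icc (ι + 1) k, lam ℓ) / ((s : ℝ) - ι)

/-- The defining property of the unique index `ι` of Lemma 1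
(with the convention `λ_0 = +∞`, so for `ι = 0` the left inequality is vacuous). -/
def IsIota (k s : ℕ) (lam : ℕ → ℝ) (ι : ℕ) : Prop :=
  ι < s ∧ (1 ≤ ι → avgTail k s lam ι < lam ι) ∧ lam (ι + 1) ≤ avgTail k s lam ι

/-- The unique index `ι` of Lemma 1 (junk value `0` if no such index exists). -/
def iotaOf (k s : ℕ) (lam : ℕ → ℝ) : ℕ :=
  if h : ∃ ι, IsIota k s lam ι then h.choose else 0

/-- `φ_s(λ) = Σ_{ℓ=1}^ι log λ_ℓ + (s−ι) log((1/(s−ι)) Σ_{ℓ=ι+1}^k λ_ℓ)`. -/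
def phiS (k s : ℕ) (lam : ℕ → ℝ) : ℝ :=
  (∑ ℓ ∈ Finset.Icc 1 (iotaOf k s lam), Real.log (lam ℓ)) +
    ((s : ℝ) - iotaOf k s lam) * Real.log (avgTail k s lam (iotaOf k s lam))

/-- The decreasingly ordered eigenvalues of a symmetric matrix, indexed from `1`
(junk value `0` outside `[1,k]` or if `X` is not Hermitian). -/
def eigsDesc (k : ℕ) (X : Matrix (Fin k) (Fin k) ℝ) : ℕ → ℝ := fun i =>
  if h : X.IsHermitian then
    ((((List.ofFn h.eigenvalues : List ℝ) : Multiset ℝ).sort (· ≤ ·)).reverse).getD (i - 1) 0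
  else 0

/-- `Γ_s(X) = φ_s(λ(X))` with `λ(X)` the decreasingly ordered eigenvalues of `X`. -/
def gammaS (k s : ℕ) (X : Matrix (Fin k) (Fin k) ℝ) : ℝ :=
  phiS k s (eigsDesc k X)

/-- `F_DDFact(x;Υ) = Fᵀ Diag(Υ∘x) F = Σ_i γ_i x_i F_{i·}ᵀ F_{i·}`. -/
def FDD (n k : ℕ) (F : Matrix (Fin n) (Fin k) ℝ) (x Υ : Fin n → ℝ) :
    Matrix (Fin k) (Fin k) ℝ :=
  Fᵀ * Matrix.diagonal (fun i => Υ i * x i) * F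

/-- `f_DDFact(x;Υ) = Γ_s(F_DDFact(x;Υ)) − Σ_i x_i log γ_i`. -/
def fDD (n k s : ℕ) (F : Matrix (Fin n) (Fin k) ℝ) (x Υ : Fin n → ℝ) : ℝ :=
  gammaS k s (FDD n k F x Υ) - ∑ i, x i * Real.log (Υ i)

/-- `β` of Definition 1: `β_i = 1/λ_i` for `i ≤ ι` and
`β_i = (s−ι)/Σ_{ℓ=ι+1}^k λ_ℓ` for `i > ι` (here `β` is indexed by `Fin k`, `j ↔ j+1`). -/
def betaOf (k s : ℕ) (lam : ℕ → ℝ) : Fin k → ℝ := fun j =>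
  if (j : ℕ) + 1 ≤ iotaOf k s lam then (lam ((j : ℕ) + 1))⁻¹
  else ((s : ℝ) - iotaOf k s lam) / ∑ ℓ ∈ Finset.Icc (iotaOf k s lam + 1) k, lam ℓ

/-- `F Q Diag(β) Qᵀ Fᵀ`, whose diagonal appears in the (generalized) gradients. -/
def gMat (n k s : ℕ) (F : Matrix (Fin n) (Fin k) ℝ) (Q : Matrix (Fin k) (Fin k) ℝ)
    (lam : ℕ → ℝ) : Matrix (Fin n) (Fin n) ℝ :=
  F * Q * Matrix.diagonal (betaOf k s lam) * Qᵀ * Fᵀ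

/-- `Q, λ` form a spectral decomposition of `F_DDFact(x;Υ)` as in Definition 1:
`Q` orthonormal and `F_DDFact(x;Υ) = Q Diag(λ) Qᵀ` with `λ` decreasing and nonnegative
(indexed from `1`). -/
def IsSpectralDecomp (n k : ℕ) (F : Matrix (Fin n) (Fin k) ℝ) (x Υ : Fin n → ℝ)
    (Q : Matrix (Fin k) (Fin k) ℝ) (lam : ℕ → ℝ) : Prop :=
  Q * Qᵀ = 1 ∧
  FDD n k F x Υ = Q * Matrix.diagonal (fun j : Fin k => lam ((j : ℕ) + 1)) * Qᵀ ∧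
  (∀ i, 0 ≤ lam i) ∧
  (∀ i j, 1 ≤ i → i ≤ j → j ≤ k → lam j ≤ lam i)

/-- Euclidean (2-)norm of a vector in `ℝⁿ`. -/
def enorm2 (n : ℕ) (v : Fin n → ℝ) : ℝ :=
  Real.sqrt (∑ i, (v i) ^ 2)

/-- The value of the formula defining `phiS` at a candidate index `ι`. -/
def phiAt (k s : ℕ) (lam : ℕ → ℝ) (ι : ℕ) : ℝ :=
  (∑ ℓ ∈ Finset.Icc 1 ι, Real.log (lam ℓ)) +
    ((s : ℝ) - ι) * Real.log (avgTail k s lam ι)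

/-- The closed version of `IsIota`, with both inequalities weak. -/
def IsWeakIota (k s : ℕ) (lam : ℕ → ℝ) (ι : ℕ) : Prop :=
  ι < s ∧ (1 ≤ ι → avgTail k s lam ι ≤ lam ι) ∧ lam (ι + 1) ≤ avgTail k s lam ι

/-- `lam` is nonincreasing on `[1,k]`. -/
def DescUpTo (k : ℕ) (lam : ℕ → ℝ) : Prop :=
  ∀ i j, 1 ≤ i → i ≤ j → j ≤ k → lam j ≤ lam i

lemma IsIota.isWeakIota {k s : ℕ} {lam : ℕ → ℝ} {ι : ℕ} (h : IsIota k s lam ι) :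
    IsWeakIota k s lam ι :=
  ⟨h.1, fun h1 => (h.2.1 h1).le, h.2.2⟩

lemma sub_mul_avgTail {k s : ℕ} (lam : ℕ → ℝ) {ι : ℕ} (hι : ι < s) :
    ((s : ℝ) - ι) * avgTail k s lam ι = ∑ ℓ ∈ Finset.Icc (ι + 1) k, lam ℓ := by
  have h : (0 : ℝ) < (s : ℝ) - ι := sub_pos.2 (by exact_mod_cast hι)
  rw [avgTail, mul_div_cancel₀ _ h.ne']

lemma avgTail_step {k s : ℕ} (hsk : s ≤ k) (lam : ℕ → ℝ) {ι : ℕ} (hι : ι + 1 < s) :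
    ((s : ℝ) - ι) * avgTail k s lam ι =
      lam (ι + 1) + ((s : ℝ) - ι - 1) * avgTail k s lam (ι + 1) := by
  have h := sub_mul_avgTail (k := k) lam hι
  push_cast at h
  rw [sub_mul_avgTail lam (by lia), sub_sub, h,
    ← Finset.insert_Icc_add_one_left_eq_Icc (by lia : ι + 1 ≤ k), Finset.sum_insert (by simp)]

lemma le_avgTail_succ {k s : ℕ} (hsk : s ≤ k) {lam : ℕ → ℝ} {ι : ℕ} (hι : ι + 1 < s)
    (h : lam (ι + 1) ≤ avgTail k s lam ι) : lam (ι + 1) ≤ avgTail k s lam (ι + 1) := by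
  have h1 := avgTail_step hsk lam hι
  have h2 : (0 : ℝ) < (s : ℝ) - ι - 1 := by
    have : ((ι + 1 : ℕ) : ℝ) < s := by exact_mod_cast hι
    push_cast at this; linarith
  by_contra! hc
  nlinarith

lemma le_avgTail_of_lt {k s : ℕ} (hsk : s ≤ k) {lam : ℕ → ℝ} (hd : DescUpTo k lam) {ι : ℕ}
    (h : lam (ι + 1) ≤ avgTail k s lam ι) (m : ℕ) (hm : ι ≤ m) (hms : m + 1 < s) :
    lam (m + 1) ≤ avgTail k s lam (m + 1) := by
  induction m, hm using Nat.le_induction with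
  | base => exact le_avgTail_succ hsk hms h
  | succ m hm ih =>
    exact le_avgTail_succ hsk hms
      ((hd (m + 1) (m + 1 + 1) (by lia) (by lia) (by lia)).trans (ih (by lia)))

lemma exists_isIota {k s : ℕ} (hs : 0 < s) (hsk : s ≤ k) {lam : ℕ → ℝ} (hnn : ∀ i, 0 ≤ lam i) :
    ∃ ι, IsIota k s lam ι := by
  have hle : lam (s - 1 + 1) ≤ avgTail k s lam (s - 1) := by
    have h := sub_mul_avgTail (k := k) lam (show s - 1 < s by lia)
    rw [Nat.cast_sub hs, Nat.cast_one, sub_sub_cancel, one_mul] at h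
    rw [h]
    exact Finset.single_le_sum (f := lam) (fun i _ => hnn i) (by simp; lia)
  have hex : ∃ ι, lam (ι + 1) ≤ avgTail k s lam ι := ⟨s - 1, hle⟩
  have hlt : Nat.find hex < s := by
    have := Nat.find_min' hex hle
    lia
  refine ⟨Nat.find hex, hlt, fun h1 => ?_, Nat.find_spec hex⟩
  obtain ⟨m, hm⟩ : ∃ m, Nat.find hex = m + 1 := ⟨Nat.find hex - 1, by lia⟩
  have h2 := Nat.find_min hex (m := m) (by lia)
  rw [hm] at hlt ⊢
  have h3 := avgTail_step hsk lam hlt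
  have h4 : (0 : ℝ) < (s : ℝ) - m - 1 := by
    have : ((m + 1 : ℕ) : ℝ) < s := by exact_mod_cast hlt
    push_cast at this; linarith
  by_contra! hc
  push Not at h2
  nlinarith

lemma isIota_iotaOf {k s : ℕ} (hs : 0 < s) (hsk : s ≤ k) {lam : ℕ → ℝ} (hnn : ∀ i, 0 ≤ lam i) :
    IsIota k s lam (iotaOf k s lam) := by
  have h := exists_isIota hs hsk hnn
  rw [iotaOf, dif_pos h]
  exact h.choose_spec

lemma phiAt_eq_phiAt {k s : ℕ} (hsk : s ≤ k) {lam : ℕ → ℝ} (hd : DescUpTo k lam) {j : ℕ}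
    (hj : IsIota k s lam j) (ι : ℕ) (hι : IsWeakIota k s lam ι) :
    phiAt k s lam ι = phiAt k s lam j := by
  have hle : j ≤ ι := by
    by_contra! hlt
    obtain ⟨m, rfl⟩ : ∃ m, j = m + 1 := ⟨j - 1, by lia⟩
    exact (hj.2.1 (by lia)).not_ge
      (le_avgTail_of_lt hsk hd hι.2.2 m (by lia) hj.1)
  induction ι, hle using Nat.le_induction with
  | base => rfl
  | succ ι hle ih =>
    have h1 := le_avgTail_of_lt hsk hd hj.2.2 ι hle hι.1
    have h2 : avgTail k s lam (ι + 1) = lam (ι + 1) := le_antisymm (hι.2.1 (by lia)) h1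
    have h3 := avgTail_step hsk lam hι.1
    have h4 : (0 : ℝ) < (s : ℝ) - ι := sub_pos.2 (by exact_mod_cast (by have := hι.1; lia))
    have h5 : avgTail k s lam ι = lam (ι + 1) := by
      rw [h2] at h3
      refine mul_left_cancel₀ h4.ne' (h3.trans (by ring))
    have hsι := hι.1
    rw [← ih ⟨by lia, fun h => h5.trans_le (hd ι (ι + 1) h (by lia) (by lia)), h5.ge⟩]
    rw [phiAt, phiAt, h2, h5, Finset.sum_Icc_succ_top (by lia)]
    push_cast
    ring

lemma tendsto_phiS {α : Type*} {l : Filter α} {k s : ℕ} (hs : 0 < s) (hsk : s ≤ k)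
    {L : α → ℕ → ℝ} {L₀ : ℕ → ℝ} (hL : ∀ i, Filter.Tendsto (fun a => L a i) l (nhds (L₀ i)))
    (hnn : ∀ᶠ a in l, ∀ i, 0 ≤ L a i) (hnn₀ : ∀ i, 0 ≤ L₀ i) (hd₀ : DescUpTo k L₀)
    (hpos : 0 < L₀ s) :
    Filter.Tendsto (fun a => phiS k s (L a)) l (nhds (phiS k s L₀)) := by
  have havg (ι : ℕ) : Filter.Tendsto (fun a => avgTail k s (L a) ι) l
      (nhds (avgTail k s L₀ ι)) :=
    (tendsto_finsetSum _ fun i _ => hL i).div_const _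
  intro U hU
  have key (ι : ℕ) (hι : ι < s) :
      ∀ᶠ a in l, IsWeakIota k s (L a) ι → phiAt k s (L a) ι ∈ U := by
    by_cases hw : IsWeakIota k s L₀ ι
    · have hphi : phiAt k s L₀ ι = phiS k s L₀ :=
        phiAt_eq_phiAt hsk hd₀ (isIota_iotaOf hs hsk hnn₀) ι hw
      have hsum : 0 < ∑ ℓ ∈ Finset.Icc (ι + 1) k, L₀ ℓ :=
        hpos.trans_le (Finset.single_le_sum (f := L₀) (fun i _ => hnn₀ i) (by simp; lia))
      have hpa : 0 < avgTail k s L₀ ι :=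
        div_pos hsum (sub_pos.2 (by exact_mod_cast hι))
      have ht : Filter.Tendsto (fun a => phiAt k s (L a) ι) l (nhds (phiS k s L₀)) := by
        rw [← hphi]
        refine (tendsto_finsetSum _ fun i hi => ?_).add (((havg ι).log hpa.ne').const_mul _)
        rw [Finset.mem_Icc] at hi
        exact (hL i).log (hpos.trans_le (hd₀ i s hi.1 (by lia) hsk)).ne'
      filter_upwards [ht hU] with a ha _ using ha
    · have hcases : (1 ≤ ι ∧ L₀ ι < avgTail k s L₀ ι) ∨ avgTail k s L₀ ι < L₀ (ι + 1) := by
        by_contra! hc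
        exact hw ⟨hι, hc.1, hc.2⟩
      rcases hcases with ⟨h1, h2⟩ | h2
      · filter_upwards [(hL ι).eventually_lt (havg ι) h2] with a ha hwa
        exact absurd (hwa.2.1 h1) ha.not_ge
      · filter_upwards [(havg ι).eventually_lt (hL (ι + 1)) h2] with a ha hwa
        exact absurd hwa.2.2 ha.not_ge
  have hall : ∀ᶠ a in l, ∀ ι ∈ Finset.range s, IsWeakIota k s (L a) ι → phiAt k s (L a) ι ∈ U :=
    (Finset.eventually_all _).2 fun ι hι => key ι (Finset.mem_range.1 hι)
  change ∀ᶠ a in l, phiS k s (L a) ∈ U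
  filter_upwards [hall, hnn] with a ha hna
  have h := isIota_iotaOf hs hsk hna
  exact ha _ (Finset.mem_range.2 h.1) h.isWeakIota

lemma eigsDesc_of_eq_conj {k : ℕ} {X Q : Matrix (Fin k) (Fin k) ℝ} {d : Fin k → ℝ}
    (hd : Antitone d) (hQ : Q * Qᵀ = 1) (hX : X = Q * diagonal d * Qᵀ) (i : ℕ) :
    eigsDesc k X i = (List.ofFn d).getD (i - 1) 0 := by
  have hH : X.IsHermitian := by
    rw [IsHermitian, conjTranspose_eq_transpose_of_trivial, hX]
    simp [Matrix.mul_assoc]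
  have hchar : X.charpoly = (diagonal d).charpoly := by
    rw [hX, charpoly_mul_comm, ← Matrix.mul_assoc, mul_eq_one_comm.1 hQ, Matrix.one_mul]
  have hroots : (Finset.univ.val.map hH.eigenvalues) = Finset.univ.val.map d := by
    have h1 := hH.roots_charpoly_eq_eigenvalues
    have h2 : ∏ i, (Polynomial.X - Polynomial.C (d i)) =
        ((Finset.univ.val.map d).map fun a => Polynomial.X - Polynomial.C a).prod := by
      rw [Multiset.map_map]; rfl
    rw [hchar, charpoly_diagonal, h2, Polynomial.roots_multiset_prod_X_sub_C] at h1
    exact h1.symm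
  have hperm : ((List.ofFn hH.eigenvalues : List ℝ) : Multiset ℝ) = (List.ofFn d : List ℝ) := by
    simpa [Fin.univ_val_map] using hroots
  rw [eigsDesc, dif_pos hH, hperm]
  congr 1
  refine List.Perm.eq_of_sortedGE ?_ hd.sortedGE_ofFn ?_
  · exact (Multiset.pairwise_sort _ _).sortedLE.reverse
  · refine (List.reverse_perm _).trans (Multiset.coe_eq_coe.1 ?_)
    rw [Multiset.sort_eq]

lemma exists_antitone_conj {k : ℕ} {X : Matrix (Fin k) (Fin k) ℝ} (hX : X.IsHermitian) :
    ∃ (Q : Matrix (Fin k) (Fin k) ℝ) (d : Fin k → ℝ),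
      Antitone d ∧ Q * Qᵀ = 1 ∧ X = Q * diagonal d * Qᵀ := by
  let σ : Equiv.Perm (Fin k) := Tuple.sort (fun i => - hX.eigenvalues i)
  have hσ : Monotone ((fun i => - hX.eigenvalues i) ∘ σ) := Tuple.monotone_sort _
  let U : Matrix (Fin k) (Fin k) ℝ := hX.eigenvectorUnitary
  have hU : U * Uᵀ = 1 := by
    have := Unitary.coe_mul_star_self hX.eigenvectorUnitary
    simpa [star_eq_conjTranspose] using this
  have hXU : X = U * diagonal hX.eigenvalues * Uᵀ := by
    have := hX.spectral_theorem
    simpa [Unitary.conjStarAlgAut_apply, star_eq_conjTranspose] using this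
  refine ⟨U.submatrix id σ, hX.eigenvalues ∘ σ, fun i j hij => ?_, ?_, ?_⟩
  · simpa using hσ hij
  · rw [transpose_submatrix, submatrix_mul_equiv, hU, submatrix_id_id]
  · conv_lhs => rw [hXU]
    rw [← submatrix_diagonal_equiv, transpose_submatrix, submatrix_mul_equiv, submatrix_mul_equiv,
      submatrix_id_id]

lemma isCompact_setOf_mul_transpose_eq_one (k : ℕ) :
    IsCompact {Q : Matrix (Fin k) (Fin k) ℝ | Q * Qᵀ = 1} := by
  have hK : IsCompact (Set.univ.pi fun _ : Fin k => Set.univ.pi fun _ : Fin k =>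
      Set.Icc (-1 : ℝ) 1) :=
    isCompact_univ_pi fun _ => isCompact_univ_pi fun _ => isCompact_Icc
  have hcl : IsClosed {Q : Matrix (Fin k) (Fin k) ℝ | Q * Qᵀ = 1} :=
    isClosed_eq (by fun_prop) continuous_const
  refine hK.of_isClosed_subset hcl fun (Q : Matrix (Fin k) (Fin k) ℝ) hQ i _ j _ => ?_
  have hU : Q ∈ Matrix.unitaryGroup (Fin k) ℝ := by
    rw [mem_unitaryGroup_iff]
    rwa [star_eq_conjTranspose, conjTranspose_eq_transpose_of_trivial]
  simpa [Real.norm_eq_abs, abs_le] using entry_norm_bound_of_unitary hU i j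

lemma tendsto_eigsDesc {α : Type*} {l : Filter α} {k : ℕ} {M : α → Matrix (Fin k) (Fin k) ℝ}
    {X : Matrix (Fin k) (Fin k) ℝ} (hM : ∀ a, (M a).IsHermitian)
    (hlim : Filter.Tendsto M l (nhds X)) (i : ℕ) :
    Filter.Tendsto (fun a => eigsDesc k (M a) i) l (nhds (eigsDesc k X i)) := by
  choose Q d hd hQ hQd using fun a => exists_antitone_conj (hM a)
  rw [Filter.tendsto_iff_ultrafilter]
  intro g hg
  obtain ⟨Q₀, hQ₀, hQlim⟩ := (isCompact_setOf_mul_transpose_eq_one k).ultrafilter_le_nhds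
    (g.map Q) (Filter.le_principal_iff.2
      (Filter.Eventually.of_forall hQ : ∀ᶠ a in (g : Filter α), Q a * (Q a)ᵀ = 1))
  replace hQlim : Filter.Tendsto Q g (nhds Q₀) := hQlim
  have hMlim : Filter.Tendsto M g (nhds X) := hlim.mono_left hg
  have hdiag (a : α) : d a = ((Q a)ᵀ * M a * Q a).diag := by
    have h := mul_eq_one_comm.1 (hQ a)
    calc d a = (diagonal (d a)).diag := (diag_diagonal _).symm
      _ = ((Q a)ᵀ * Q a * diagonal (d a) * ((Q a)ᵀ * Q a)).diag := by
        rw [h, Matrix.one_mul, Matrix.mul_one]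
      _ = _ := by
        conv_rhs => rw [hQd a]
        simp only [Matrix.mul_assoc]
  set d₀ : Fin k → ℝ := (Q₀ᵀ * X * Q₀).diag
  have hdlim : Filter.Tendsto d g (nhds d₀) := by
    have hc : Continuous fun p : Matrix (Fin k) (Fin k) ℝ × Matrix (Fin k) (Fin k) ℝ =>
        (p.1ᵀ * p.2 * p.1).diag := by fun_prop
    have h := (hc.tendsto (Q₀, X)).comp (hQlim.prodMk_nhds hMlim)
    exact h.congr fun a => (hdiag a).symm
  have hd₀ : Antitone d₀ := fun a b hab =>
    le_of_tendsto_of_tendsto' (tendsto_pi_nhds.1 hdlim b) (tendsto_pi_nhds.1 hdlim a)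
      fun c => hd c hab
  have hX : X = Q₀ * diagonal d₀ * Q₀ᵀ := by
    have hc : Continuous fun p : Matrix (Fin k) (Fin k) ℝ × (Fin k → ℝ) =>
        p.1 * diagonal p.2 * p.1ᵀ := by fun_prop
    refine tendsto_nhds_unique hMlim ?_
    have h := (hc.tendsto (Q₀, d₀)).comp (hQlim.prodMk_nhds hdlim)
    exact h.congr fun a => (hQd a).symm
  simp only [eigsDesc_of_eq_conj hd₀ hQ₀ hX, fun a => eigsDesc_of_eq_conj (hd a) (hQ a) (hQd a)]
  by_cases hi : i - 1 < k
  · simpa [hi] using tendsto_pi_nhds.1 hdlim ⟨i - 1, hi⟩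
  · simp [hi]

lemma eigsDesc_nonneg {k : ℕ} {X : Matrix (Fin k) (Fin k) ℝ} (hX : X.PosSemidef) (i : ℕ) :
    0 ≤ eigsDesc k X i := by
  obtain ⟨Q, d, hd, hQ, hQd⟩ := exists_antitone_conj hX.isHermitian
  have hdiag : Qᵀ * X * Q = diagonal d := by
    have h := mul_eq_one_comm.1 hQ
    calc Qᵀ * X * Q = Qᵀ * Q * diagonal d * (Qᵀ * Q) := by rw [hQd]; simp only [Matrix.mul_assoc]
      _ = _ := by rw [h, Matrix.one_mul, Matrix.mul_one]
  have hps : (diagonal d).PosSemidef := by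
    rw [← hdiag]
    simpa using hX.conjTranspose_mul_mul_same Q
  rw [eigsDesc_of_eq_conj hd hQ hQd]
  by_cases hi : i - 1 < k
  · simpa [hi] using posSemidef_diagonal_iff.1 hps ⟨i - 1, hi⟩
  · simp [hi]

lemma descUpTo_eigsDesc {k : ℕ} {X : Matrix (Fin k) (Fin k) ℝ} (hX : X.IsHermitian) :
    DescUpTo k (eigsDesc k X) := by
  obtain ⟨Q, d, hd, hQ, hQd⟩ := exists_antitone_conj hX
  intro i j hi hij hj
  rw [eigsDesc_of_eq_conj hd hQ hQd, eigsDesc_of_eq_conj hd hQ hQd]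
  have h1 : i - 1 < k := by lia
  have h2 : j - 1 < k := by lia
  simpa [h1, h2] using hd (show (⟨i - 1, h1⟩ : Fin k) ≤ ⟨j - 1, h2⟩ from Nat.sub_le_sub_right hij 1)

lemma eigsDesc_pos_of_le_rank {k s : ℕ} {X : Matrix (Fin k) (Fin k) ℝ} (hX : X.PosSemidef)
    (hs : 0 < s) (hsX : s ≤ X.rank) : 0 < eigsDesc k X s := by
  have hsk : s ≤ k := hsX.trans (by simpa using X.rank_le_card_width)
  have hdesc := descUpTo_eigsDesc hX.isHermitian
  refine (eigsDesc_nonneg hX s).lt_of_ne' fun h0 => ?_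
  have hzero (j : ℕ) (hsj : s ≤ j) (hj : j ≤ k) : eigsDesc k X j = 0 :=
    le_antisymm (h0 ▸ hdesc s j hs hsj hj) (eigsDesc_nonneg hX j)
  obtain ⟨Q, d, hd, hQ, hQd⟩ := exists_antitone_conj hX.isHermitian
  have hdet : IsUnit Q.det := isUnit_det_of_right_inverse hQ
  have hdet' : IsUnit Qᵀ.det := isUnit_det_of_left_inverse hQ
  have hrank : X.rank = Fintype.card {i // d i ≠ 0} := by
    rw [hQd, rank_mul_eq_left_of_isUnit_det _ _ hdet', rank_mul_eq_right_of_isUnit_det _ _ hdet,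
      rank_diagonal]
  have hcard : Fintype.card {i // d i ≠ 0} ≤ Fintype.card (Fin (s - 1)) := by
    refine Fintype.card_le_of_injective (fun i => ⟨i.1.1, ?_⟩) fun i j hij => ?_
    · by_contra! hc
      have hi := i.1.2
      have h := hzero (i.1.1 + 1) (by lia) hi
      rw [eigsDesc_of_eq_conj hd hQ hQd] at h
      exact i.2 (by simpa using h)
    · exact Subtype.ext (Fin.ext (by simpa using hij))
  rw [← hrank, Fintype.card_fin] at hcard
  lia

lemma continuous_FDD (n k : ℕ) (F : Matrix (Fin n) (Fin k) ℝ) :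
    Continuous fun p : (Fin n → ℝ) × (Fin n → ℝ) => FDD n k F p.1 p.2 := by
  unfold FDD
  fun_prop

lemma isHermitian_FDD {n k : ℕ} (F : Matrix (Fin n) (Fin k) ℝ) (x Υ : Fin n → ℝ) :
    (FDD n k F x Υ).IsHermitian := by
  rw [IsHermitian, conjTranspose_eq_transpose_of_trivial, FDD]
  simp [Matrix.mul_assoc]

lemma posSemidef_FDD {n k : ℕ} (F : Matrix (Fin n) (Fin k) ℝ) {x Υ : Fin n → ℝ}
    (hx : ∀ i, 0 ≤ x i) (hΥ : ∀ i, 0 < Υ i) : (FDD n k F x Υ).PosSemidef := by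
  have h : (diagonal fun i => Υ i * x i).PosSemidef :=
    PosSemidef.diagonal fun i => mul_nonneg (hΥ i).le (hx i)
  simpa [FDD] using h.conjTranspose_mul_mul_same F

/-- Corollary 1: `(x,Υ) ↦ f_DDFact(x;Υ)` is continuous on
`{(x,Υ) : Υ ∈ ℝⁿ₊₊, x ∈ dom(f_DDFact;Υ)₊}`. -/
theorem stmt_16 (n k s r : ℕ) (hn : 1 < n) (hs0 : 0 < s) (hsn : s < n)
    (C : Matrix (Fin n) (Fin n) ℝ) (hC : C.PosSemidef)
    (hr : C.rank = r) (hrs : s ≤ r)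
    (F : Matrix (Fin n) (Fin k) ℝ) (hF : C = F * Fᵀ) (hk1 : r ≤ k) (hk2 : k ≤ n) :
    ContinuousOn (fun p : (Fin n → ℝ) × (Fin n → ℝ) => fDD n k s F p.1 p.2)
      {p : (Fin n → ℝ) × (Fin n → ℝ) |
        (∀ i, 0 < p.2 i) ∧ (∀ i, 0 ≤ p.1 i) ∧ s ≤ (FDD n k F p.1 p.2).rank} := by
  rintro ⟨x, Υ⟩ ⟨hΥ, hx, hrank⟩
  have hps := posSemidef_FDD F hx hΥ
  refine Filter.Tendsto.sub ?_ (tendsto_finsetSum _ fun i _ => ?_)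
  · have hF₀ := ((continuous_FDD n k F).tendsto (x, Υ)).mono_left
      (nhdsWithin_le_nhds (s := {p : (Fin n → ℝ) × (Fin n → ℝ) |
        (∀ i, 0 < p.2 i) ∧ (∀ i, 0 ≤ p.1 i) ∧ s ≤ (FDD n k F p.1 p.2).rank}))
    have hlim := fun i => tendsto_eigsDesc
      (fun p : (Fin n → ℝ) × (Fin n → ℝ) => isHermitian_FDD F p.1 p.2) hF₀ i
    refine tendsto_phiS hs0 (hrs.trans hk1) hlim
      ?_ (eigsDesc_nonneg hps) (descUpTo_eigsDesc hps.isHermitian)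
      (eigsDesc_pos_of_le_rank hps hs0 hrank)
    filter_upwards [self_mem_nhdsWithin] with p hp
    exact eigsDesc_nonneg (posSemidef_FDD F hp.2.1 hp.1)
  · have h1 : ContinuousAt (fun p : (Fin n → ℝ) × (Fin n → ℝ) => p.1 i) (x, Υ) := by fun_prop
    have h2 : ContinuousAt (fun p : (Fin n → ℝ) × (Fin n → ℝ) => p.2 i) (x, Υ) := by fun_prop
    exact (h1.mul (h2.log (hΥ i).ne')).continuousWithinAt

end
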